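/- Let λ > 0, ε > 0, d ≥ 1 and s > 1/2. Suppose T_t ∈ ℂ^{2d×2d}, for 0 ≤ t ≤ ε, is a family of symmetric matrices (T_tᵀ = T_t) such that for every t ∈ [0,ε]: the real part Re T_t is negative semidefinite, and both real symmetric matrices Re T_t and Im T_t have all eigenvalues in the interval [−λ, λ]. Let a_t(z) = exp(½⟨T_t z, z⟩) for z ∈ ℝ^{2d}, where ⟨T z, z⟩ = Σ_{j,k} T_{jk} z_j z_k. Then for each μ > 0 there exists δ > 0 such that, provided λ ≤ δ, for every h > 0 there is a constant C > 0 with |∂^α a_t(z)| ≤ C h^{|α|} (α!)^s exp(μ h^{−1/s} |z|^{1/s}) for all z ∈ ℝ^{2d}, all multi-indices α ∈ ℕ^{2d}, and all t ∈ [0,ε]. -/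

import Mathlib

open scoped Nat

/-- Partial derivative in the `j`-th coordinate direction. -/
noncomputable def pd {n : ℕ} (j : Fin n) (f : EuclideanSpace ℝ (Fin n) → ℂ) :
    EuclideanSpace ℝ (Fin n) → ℂ :=
  fun z => fderiv ℝ f z (EuclideanSpace.single j 1)

/-- Iterated partial derivative `∂^α` for a multi-index `α ∈ ℕ^n`. -/
noncomputable def pdMulti {n : ℕ} (α : Fin n → ℕ) (f : EuclideanSpace ℝ (Fin n) → ℂ) :
    EuclideanSpace ℝ (Fin n) → ℂ :=
  (List.finRange n).foldr (fun j g => (pd j)^[α j] g) f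

/-- The real part of a complex matrix, as a real matrix. -/
def matRe {m : ℕ} (T : Matrix (Fin m) (Fin m) ℂ) : Matrix (Fin m) (Fin m) ℝ :=
  Matrix.of fun i j => (T i j).re

/-- The imaginary part of a complex matrix, as a real matrix. -/
def matIm {m : ℕ} (T : Matrix (Fin m) (Fin m) ℂ) : Matrix (Fin m) (Fin m) ℝ :=
  Matrix.of fun i j => (T i j).im


open scoped ContDiff

theorem num_rec (s g c x : ℝ) (hg : 0 < g) (hc : 0 ≤ c) (hx : 0 ≤ x) (hs : 0 < s)
    (A : ℕ → ℝ) (h0 : A 0 ≤ 1) (h1 : A 1 ≤ x * A 0)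
    (h2 : ∀ k : ℕ, A (k + 2) ≤ x * A (k + 1) + (k + 1 : ℝ) * c * A k)
    (e : ℕ → ℝ) (he : ∀ k : ℕ, e k = c / g ^ 2 * (k / ((k : ℝ) ^ s * ((k : ℝ) + 1) ^ s)))
    (k : ℕ) :
    A k ≤ (∏ i ∈ Finset.range k, (1 + e i)) * (g ^ k * ((k ! : ℝ)) ^ s *
      ∑ m ∈ Finset.range (k + 1), (x / g) ^ m / ((m ! : ℝ)) ^ s) := by
  have he0 : ∀ k, 0 ≤ e k := fun k => by rw [he]; positivity
  set D : ℕ → ℝ := fun k => ∏ i ∈ Finset.range k, (1 + e i) with hD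
  set w : ℕ → ℝ := fun k => ∑ m ∈ Finset.range (k + 1), (x / g) ^ m / ((m ! : ℝ)) ^ s with hw
  have hDpos : ∀ k, 0 < D k := fun k => Finset.prod_pos fun i _ => by linarith [he0 i]
  have hDs : ∀ k, D (k + 1) = D k * (1 + e k) := fun k => Finset.prod_range_succ _ _
  have hDm : ∀ k, D k ≤ D (k + 1) := fun k => by
    rw [hDs]; nlinarith [hDpos k, he0 k]
  have hw0 : ∀ k, 0 ≤ w k := fun k => Finset.sum_nonneg fun i _ => by positivity
  have hwm : ∀ k, w k ≤ w (k + 1) := fun k => by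
    simp only [hw]
    rw [Finset.sum_range_succ _ (k + 1)]
    have : 0 ≤ (x / g) ^ (k + 1) / (((k + 1)! : ℕ) : ℝ) ^ s := by positivity
    linarith
  have hfs : ∀ k : ℕ, ((((k + 1)! : ℕ)) : ℝ) ^ s = ((k : ℝ) + 1) ^ s * ((k ! : ℕ) : ℝ) ^ s := by
    intro k
    rw [Nat.factorial_succ, Nat.cast_mul, Real.mul_rpow (by positivity) (by positivity)]
    push_cast; rfl
  have hws : ∀ k : ℕ, x / g * w k ≤ ((k : ℝ) + 1) ^ s * w (k + 1) := by
    intro k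
    simp only [hw]
    rw [Finset.sum_range_succ' _ (k + 1), mul_add, Finset.mul_sum, Finset.mul_sum]
    refine le_add_of_le_of_nonneg (Finset.sum_le_sum fun m hm => ?_) (by positivity)
    rw [hfs, pow_succ, ← mul_div_assoc, ← mul_div_assoc, div_le_div_iff₀ (by positivity) (by positivity)]
    have : ((m : ℝ) + 1) ^ s ≤ ((k : ℝ) + 1) ^ s := by
      apply Real.rpow_le_rpow (by positivity) _ hs.le
      have : m ≤ k := by simpa [Nat.lt_succ_iff] using hm
      have : (m : ℝ) ≤ k := by exact_mod_cast this
      linarith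
    calc _ = (x / g * (x / g) ^ m * (m ! : ℝ) ^ s) * ((m : ℝ) + 1) ^ s := by ring
      _ ≤ (x / g * (x / g) ^ m * (m ! : ℝ) ^ s) * ((k : ℝ) + 1) ^ s := by gcongr
      _ = _ := by ring
  have hstep : ∀ k : ℕ, ∀ a : ℝ, a ≤ D k * (g ^ k * ((k ! : ℝ)) ^ s * w k) →
      x * a ≤ D k * (g ^ (k + 1) * ((((k + 1)! : ℕ)) : ℝ) ^ s * w (k + 1)) := by
    intro k a ha
    calc x * a ≤ x * (D k * (g ^ k * ((k ! : ℝ)) ^ s * w k)) := by gcongr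
      _ = (D k * g ^ (k + 1) * (k ! : ℝ) ^ s) * (x / g * w k) := by field_simp; ring
      _ ≤ (D k * g ^ (k + 1) * (k ! : ℝ) ^ s) * (((k : ℝ) + 1) ^ s * w (k + 1)) := by
        have := hws k
        have := hDpos k
        gcongr
      _ = _ := by rw [hfs]; ring
  have hnn : ∀ k, 0 ≤ g ^ k * ((k ! : ℝ)) ^ s * w k := fun k => by
    have := hw0 k
    positivity
  change A k ≤ D k * (g ^ k * ((k ! : ℝ)) ^ s * w k)
  induction k using Nat.strong_induction_on with
  | _ k ih =>
    match k with
    | 0 => simpa [hD, hw] using h0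
    | 1 =>
      refine h1.trans ((hstep 0 _ (ih 0 (by norm_num))).trans ?_)
      exact mul_le_mul_of_nonneg_right (hDm 0) (hnn 1)
    | k + 2 =>
      have i1 := hstep (k + 1) _ (ih (k + 1) (by omega))
      have i0 := ih k (by omega)
      have i2 : (k + 1 : ℝ) * c * A k ≤
          D (k + 1) * e (k + 1) * (g ^ (k + 2) * ((((k + 2)! : ℕ)) : ℝ) ^ s * w (k + 2)) := by
        calc (k + 1 : ℝ) * c * A k ≤ (k + 1 : ℝ) * c * (D k * (g ^ k * ((k ! : ℝ)) ^ s * w k)) := by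
              gcongr
          _ = D k * e (k + 1) * (g ^ (k + 2) * ((((k + 2)! : ℕ)) : ℝ) ^ s * w k) := by
            rw [he, hfs (k + 1), hfs k]
            push_cast
            have p1 : 0 < ((k : ℝ) + 1) ^ s := by positivity
            have p2 : 0 < ((k : ℝ) + 1 + 1) ^ s := by positivity
            field_simp
            ring
          _ ≤ _ := by
            have := he0 (k + 1)
            have := hDm k
            have := (hwm k).trans (hwm (k + 1))
            have := hDpos (k + 1)
            have := hw0 k
            gcongr
      have := h2 k
      have e1 : D (k + 2) = D (k + 1) * (1 + e (k + 1)) := hDs (k + 1)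
      rw [e1]
      nlinarith

theorem prod_bound (e : ℕ → ℝ) (he0 : ∀ k, 0 ≤ e k) (he : Filter.Tendsto e Filter.atTop (nhds 0)) :
    ∃ C : ℝ, 0 < C ∧ ∀ k, ∏ i ∈ Finset.range k, (1 + e i) ≤ C * 2 ^ k := by
  obtain ⟨N, hN⟩ := Filter.eventually_atTop.1 (he.eventually (ge_mem_nhds (zero_lt_one)))
  set D : ℕ → ℝ := fun k => ∏ i ∈ Finset.range k, (1 + e i) with hD
  have hDpos : ∀ k, 0 < D k := fun k => Finset.prod_pos fun i _ => by linarith [he0 i]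
  have hDs : ∀ k, D (k + 1) = D k * (1 + e k) := fun k => Finset.prod_range_succ _ _
  have hDm : Monotone D := monotone_nat_of_le_succ fun k => by
    rw [hDs]; nlinarith [hDpos k, he0 k]
  refine ⟨D N, hDpos N, fun k => ?_⟩
  change D k ≤ _
  induction k with
  | zero => simpa using hDm (Nat.zero_le N)
  | succ k ih =>
    rcases le_total N k with h | h
    · rw [hDs, pow_succ]
      have := hN k h
      have := he0 k
      have := hDpos k
      calc D k * (1 + e k) ≤ (D N * 2 ^ k) * 2 :=
            mul_le_mul ih (by linarith) (by linarith) (this.le.trans ih)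
        _ = _ := by ring
    · rcases h.eq_or_lt with h | h
      · subst h
        rw [hDs, pow_succ]
        have := hN k le_rfl
        have := he0 k
        have := hDpos k
        calc D k * (1 + e k) ≤ (D k * 2 ^ k) * 2 := by gcongr; linarith
          _ = _ := by ring
      · have h1 := hDm (Nat.succ_le_of_lt h)
        have h2 : (1:ℝ) ≤ 2 ^ (k + 1) := one_le_pow₀ (by norm_num)
        have := hDpos N
        simp only [Nat.succ_eq_add_one] at h1
        nlinarith

theorem e_tendsto (s b : ℝ) (hs : 1 / 2 < s) :
    Filter.Tendsto (fun k : ℕ => b * ((k : ℝ) / ((k : ℝ) ^ s * ((k : ℝ) + 1) ^ s)))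
      Filter.atTop (nhds 0) := by
  have h1 : Filter.Tendsto (fun k : ℕ => ((k : ℝ)) ^ (-(2 * s - 1))) Filter.atTop (nhds 0) :=
    (tendsto_rpow_neg_atTop (by linarith)).comp tendsto_natCast_atTop_atTop
  have h2 : Filter.Tendsto (fun k : ℕ => ((k : ℝ) / ((k : ℝ) ^ s * ((k : ℝ) + 1) ^ s)))
      Filter.atTop (nhds 0) := by
    refine squeeze_zero' (Filter.Eventually.of_forall fun k => by positivity) ?_ h1
    filter_upwards [Filter.eventually_gt_atTop 0] with k hk
    have hk : (0 : ℝ) < k := by exact_mod_cast hk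
    have : ((k : ℝ)) ^ (-(2 * s - 1)) = k / ((k : ℝ) ^ s * (k : ℝ) ^ s) := by
      rw [← Real.rpow_add hk, show -(2 * s - 1) = 1 - (s + s) by ring, Real.rpow_sub hk,
        Real.rpow_one]
    rw [this]
    gcongr
    linarith
  simpa using h2.const_mul b

theorem w_bound (s y : ℝ) (hs : 0 < s) (hy : 0 ≤ y) (k : ℕ) :
    ∑ m ∈ Finset.range (k + 1), y ^ m / ((m ! : ℝ)) ^ s ≤ 2 ^ k * Real.exp (s * y ^ (1 / s)) := by
  have h : ∀ m ∈ Finset.range (k + 1), y ^ m / ((m ! : ℝ)) ^ s ≤ Real.exp (s * y ^ (1 / s)) := by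
    intro m _
    have h1 := Real.pow_div_factorial_le_exp (y ^ (1 / s)) (by positivity) m
    have h2 := Real.rpow_le_rpow (by positivity) h1 hs.le
    rw [Real.div_rpow (by positivity) (by positivity), ← Real.exp_mul, mul_comm _ s] at h2
    rwa [← Real.rpow_natCast, ← Real.rpow_mul hy, ← Real.rpow_mul hy,
      show 1 / s * m * s = m by field_simp, Real.rpow_natCast] at h2
  refine (Finset.sum_le_card_nsmul _ _ _ h).trans ?_
  rw [Finset.card_range, nsmul_eq_mul]
  gcongr
  have : k + 1 ≤ 2 ^ k := Nat.lt_two_pow_self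
  exact_mod_cast this

theorem fact_bound {n : ℕ} (α : Fin n → ℕ) :
    (((∑ j, α j)! : ℕ) : ℝ) ≤ (n : ℝ) ^ (∑ j, α j) * ∏ j, ((α j)! : ℝ) := by
  have h := Finset.sum_pow_eq_sum_piAntidiag (R := ℕ) Finset.univ (fun _ : Fin n => 1) (∑ j, α j)
  have hm : α ∈ Finset.piAntidiag Finset.univ (∑ j, α j) := by simp
  have h1 : Nat.multinomial Finset.univ α ≤ n ^ (∑ j, α j) := by
    simp only [one_pow, Finset.prod_const_one, mul_one, Finset.sum_const, Finset.card_univ,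
      Fintype.card_fin, smul_eq_mul] at h
    rw [h]
    exact Finset.single_le_sum (f := fun k => Nat.multinomial Finset.univ k) (fun _ _ => Nat.zero_le _) hm
  have h2 := Nat.multinomial_spec Finset.univ α
  have h3 : (∑ j, α j)! ≤ n ^ (∑ j, α j) * ∏ j, (α j)! := by
    rw [← h2, mul_comm]; gcongr
  exact_mod_cast h3

theorem iter_rec {E : Type*} [NormedAddCommGroup E] [NormedSpace ℝ E] (B : E →L[ℝ] E →L[ℝ] ℂ)
    (f : E → ℂ) (hf : ContDiff ℝ ∞ f) (hd : ∀ z, fderiv ℝ f z = f z • B z) (c : ℝ) (hB : ‖B‖ ≤ c)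
    (z : E) :
    ‖iteratedFDeriv ℝ 1 f z‖ ≤ (c * ‖z‖) * ‖iteratedFDeriv ℝ 0 f z‖ ∧
    ∀ k : ℕ, ‖iteratedFDeriv ℝ (k + 2) f z‖ ≤ (c * ‖z‖) * ‖iteratedFDeriv ℝ (k + 1) f z‖ +
      (k + 1 : ℝ) * c * ‖iteratedFDeriv ℝ k f z‖ := by
  have hfd : fderiv ℝ f = fun z => f z • B z := funext hd
  have hBz : ‖B z‖ ≤ c * ‖z‖ := (B.le_opNorm z).trans (by gcongr)
  have hB0 : ‖iteratedFDeriv ℝ 0 (fun y => B y) z‖ = ‖B z‖ := norm_iteratedFDeriv_zero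
  have hfB : fderiv ℝ (fun y => B y) = fun _ => B := funext fun y => B.fderiv
  have hB1 : ‖iteratedFDeriv ℝ 1 (fun y => B y) z‖ = ‖B‖ := by
    rw [← zero_add 1, ← norm_iteratedFDeriv_fderiv, hfB, norm_iteratedFDeriv_zero]
  have hB2 : ∀ i, ‖iteratedFDeriv ℝ (i + 2) (fun y => B y) z‖ = 0 := fun i => by
    rw [show i + 2 = (i + 1) + 1 from rfl, ← norm_iteratedFDeriv_fderiv, hfB,
      iteratedFDeriv_succ_const]
    simp
  have key : ∀ k : ℕ, ‖iteratedFDeriv ℝ (k + 1) f z‖ ≤ ∑ i ∈ Finset.range (k + 1),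
      (k.choose i : ℝ) * ‖iteratedFDeriv ℝ i (fun y => B y) z‖ * ‖iteratedFDeriv ℝ (k - i) f z‖ := by
    intro k
    rw [← norm_iteratedFDeriv_fderiv, hfd]
    exact ContinuousLinearMap.norm_iteratedFDeriv_le_of_bilinear_of_le_one
      ((ContinuousLinearMap.lsmul ℝ ℂ : ℂ →L[ℝ] (E →L[ℝ] ℂ) →L[ℝ] (E →L[ℝ] ℂ)).flip)
      (N := ∞) B.contDiff hf z (by exact_mod_cast le_top)
      ((ContinuousLinearMap.opNorm_flip _).trans_le ContinuousLinearMap.opNorm_lsmul_le)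
  refine ⟨?_, fun k => ?_⟩
  · refine (key 0).trans ?_
    simp only [zero_add, Finset.sum_range_one, Nat.choose_self, Nat.cast_one, one_mul, hB0]
    gcongr
  · refine (key (k + 1)).trans ?_
    rw [Finset.sum_range_succ', Finset.sum_range_succ']
    rw [Finset.sum_eq_zero (fun i _ => by rw [hB2]; simp)]
    rw [zero_add 1, hB0, hB1, zero_add, add_comm]
    simp only [Nat.choose_zero_right, Nat.cast_one, one_mul, Nat.sub_zero, Nat.choose_one_right]
    push_cast
    have hc0 : 0 ≤ c := (norm_nonneg B).trans hB
    gcongr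
    exact le_rfl

theorem gauss_fderiv {E : Type*} [NormedAddCommGroup E] [NormedSpace ℝ E] (B : E →L[ℝ] E →L[ℝ] ℂ)
    (hsym : ∀ x y, B x y = B y x) :
    ContDiff ℝ ∞ (fun w => Complex.exp ((1 / 2 : ℂ) * B w w)) ∧
    ∀ z, fderiv ℝ (fun w => Complex.exp ((1 / 2 : ℂ) * B w w)) z =
      Complex.exp ((1 / 2 : ℂ) * B z z) • B z := by
  constructor
  · exact Complex.contDiff_exp.comp (contDiff_const.mul (B.contDiff.clm_apply contDiff_id))
  · intro z
    have h1 : HasFDerivAt (fun w => B w w) ((2 : ℂ) • B z) z := by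
      have := (B.hasFDerivAt (x := z)).clm_apply (hasFDerivAt_id z)
      refine this.congr_fderiv ?_
      ext w
      simp [hsym w z, two_mul]
    have h2 := (h1.const_mul (1 / 2 : ℂ)).cexp
    rw [h2.fderiv, smul_smul (1 / 2 : ℂ)]
    norm_num

theorem pd_list {n : ℕ} (f : EuclideanSpace ℝ (Fin n) → ℂ) (hf : ContDiff ℝ ∞ f)
    (l : List (Fin n)) :
    l.foldr pd f = fun z => iteratedFDeriv ℝ l.length f z
      (fun i => EuclideanSpace.single (l.get i) 1) := by
  induction l with
  | nil => ext z; simp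
  | cons j l ih =>
    ext z
    rw [List.foldr_cons, ih]
    have hdiff : DifferentiableAt ℝ (iteratedFDeriv ℝ l.length f) z :=
      (hf.differentiable_iteratedFDeriv (by exact_mod_cast WithTop.coe_lt_top _)) z
    simp only [pd, List.length_cons]
    rw [iteratedFDeriv_succ_apply_left]
    rw [fderiv_continuousMultilinear_apply_const hdiff]
    rfl

theorem pdMulti_list {n : ℕ} (α : Fin n → ℕ) (f : EuclideanSpace ℝ (Fin n) → ℂ) :
    ∃ l : List (Fin n), l.length = ∑ j, α j ∧ pdMulti α f = l.foldr pd f := by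
  have hit : ∀ (j : Fin n) (k : ℕ) (g : EuclideanSpace ℝ (Fin n) → ℂ),
      (pd j)^[k] g = (List.replicate k j).foldr pd g := by
    intro j k g
    induction k with
    | zero => rfl
    | succ k ih => rw [Function.iterate_succ_apply', ih, List.replicate_succ, List.foldr_cons]
  have hl : ∀ L : List (Fin n), ∃ l : List (Fin n), l.length = (L.map α).sum ∧
      L.foldr (fun j g => (pd j)^[α j] g) f = l.foldr pd f := by
    intro L
    induction L with
    | nil => exact ⟨[], rfl, rfl⟩
    | cons j L ih =>
      obtain ⟨l, h1, h2⟩ := ih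
      refine ⟨List.replicate (α j) j ++ l, by simp [h1], ?_⟩
      rw [List.foldr_cons, h2, List.foldr_append, hit]
  obtain ⟨l, h1, h2⟩ := hl (List.finRange n)
  refine ⟨l, ?_, h2⟩
  rw [h1, ← List.ofFn_eq_map, List.sum_ofFn]

theorem pdMulti_bound {n : ℕ} (α : Fin n → ℕ) (f : EuclideanSpace ℝ (Fin n) → ℂ)
    (hf : ContDiff ℝ ∞ f) (z : EuclideanSpace ℝ (Fin n)) :
    ‖pdMulti α f z‖ ≤ ‖iteratedFDeriv ℝ (∑ j, α j) f z‖ := by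
  obtain ⟨l, h1, h2⟩ := pdMulti_list α f
  rw [h2, pd_list f hf, ← h1]
  refine (ContinuousMultilinearMap.le_opNorm _ _).trans ?_
  simp

open Matrix.Norms.L2Operator in
theorem mat_bound {n : ℕ} (A : Matrix (Fin n) (Fin n) ℝ) (hA : A.IsHermitian) (lam : ℝ)
    (hl : 0 < lam) (hsp : spectrum ℝ A ⊆ Set.Icc (-lam) lam) (x y : EuclideanSpace ℝ (Fin n)) :
    |∑ j, ∑ k, A j k * x j * y k| ≤ lam * ‖x‖ * ‖y‖ := by
  have hn : ‖A‖ ≤ lam := by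
    rw [hA.spectral_theorem, Unitary.conjStarAlgAut_apply, mul_assoc, CStarRing.norm_coe_unitary_mul,
      ← Unitary.coe_star, CStarRing.norm_mul_coe_unitary, Matrix.l2_opNorm_diagonal]
    refine (pi_norm_le_iff_of_nonneg hl.le).2 fun i => ?_
    have := hsp (hA.spectrum_real_eq_range_eigenvalues ▸ Set.mem_range_self i)
    simpa [abs_le] using this
  have h1 : ∑ j, ∑ k, A j k * x j * y k =
      inner ℝ x (WithLp.toLp 2 (A.mulVec y.ofLp) : EuclideanSpace ℝ (Fin n)) := by
    simp only [PiLp.inner_apply, Matrix.mulVec, dotProduct, RCLike.inner_apply, conj_trivial,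
      Finset.sum_mul]
    refine Finset.sum_congr rfl fun j _ => Finset.sum_congr rfl fun k _ => by ring
  rw [h1]
  refine (abs_real_inner_le_norm _ _).trans ?_
  have h2 := Matrix.l2_opNorm_mulVec A y
  calc _ ≤ ‖x‖ * (lam * ‖y‖) := by
        gcongr
        exact h2.trans (by gcongr)
    _ = _ := by ring

theorem bilin_exists {n : ℕ} (T : Matrix (Fin n) (Fin n) ℂ) (lam : ℝ) (hl : 0 < lam)
    (hsym : T.transpose = T) (hre : (-(matRe T)).PosSemidef)
    (hR : spectrum ℝ (matRe T) ⊆ Set.Icc (-lam) lam)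
    (hI : spectrum ℝ (matIm T) ⊆ Set.Icc (-lam) lam) :
    ∃ B : EuclideanSpace ℝ (Fin n) →L[ℝ] EuclideanSpace ℝ (Fin n) →L[ℝ] ℂ,
      (∀ x y, B x y = ∑ j, ∑ k, T j k * (x j : ℂ) * (y k : ℂ)) ∧ ‖B‖ ≤ 2 * lam ∧
      (∀ x y, B x y = B y x) ∧ ∀ x, (B x x).re ≤ 0 := by
  have hs : ∀ i j, T i j = T j i := fun i j => by
    conv_lhs => rw [← hsym]
    rfl
  have hRr : ∀ x y : EuclideanSpace ℝ (Fin n), (∑ j, ∑ k, T j k * (x j : ℂ) * (y k : ℂ)).re =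
      ∑ j, ∑ k, matRe T j k * x j * y k := by
    intro x y; simp [matRe]
  have hIi : ∀ x y : EuclideanSpace ℝ (Fin n), (∑ j, ∑ k, T j k * (x j : ℂ) * (y k : ℂ)).im =
      ∑ j, ∑ k, matIm T j k * x j * y k := by
    intro x y; simp [matIm]
  have hRh : (matRe T).IsHermitian := by
    ext i j; simp [matRe, hs i j]
  have hIh : (matIm T).IsHermitian := by
    ext i j; simp [matIm, hs i j]
  let f : EuclideanSpace ℝ (Fin n) →ₗ[ℝ] EuclideanSpace ℝ (Fin n) →ₗ[ℝ] ℂ :=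
    LinearMap.mk₂ ℝ (fun x y => ∑ j, ∑ k, T j k * (x j : ℂ) * (y k : ℂ))
      (by intro x x' y; simp [mul_add, add_mul, Finset.sum_add_distrib])
      (by
        intro c x y
        simp only [PiLp.smul_apply, smul_eq_mul, Complex.ofReal_mul, Complex.real_smul,
          Finset.mul_sum]
        refine Finset.sum_congr rfl fun j _ => Finset.sum_congr rfl fun k _ => by ring)
      (by intro x y y'; simp [mul_add, Finset.sum_add_distrib])
      (by
        intro c x y
        simp only [PiLp.smul_apply, smul_eq_mul, Complex.ofReal_mul, Complex.real_smul,
          Finset.mul_sum]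
        refine Finset.sum_congr rfl fun j _ => Finset.sum_congr rfl fun k _ => by ring)
  have hb : ∀ x y, ‖f x y‖ ≤ 2 * lam * ‖x‖ * ‖y‖ := by
    intro x y
    change ‖∑ j, ∑ k, T j k * (x j : ℂ) * (y k : ℂ)‖ ≤ _
    refine (Complex.norm_le_abs_re_add_abs_im _).trans ?_
    rw [hRr, hIi]
    have := mat_bound _ hRh lam hl hR x y
    have := mat_bound _ hIh lam hl hI x y
    linarith
  have hB : ∀ x y, f.mkContinuous₂ (2 * lam) hb x y =
      ∑ j, ∑ k, T j k * (x j : ℂ) * (y k : ℂ) := fun x y => rfl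
  refine ⟨f.mkContinuous₂ (2 * lam) hb, hB, f.mkContinuous₂_norm_le (by positivity) hb, ?_, ?_⟩
  · intro x y
    rw [hB, hB, Finset.sum_comm]
    refine Finset.sum_congr rfl fun j _ => Finset.sum_congr rfl fun k _ => ?_
    rw [hs k j]; ring
  · intro x
    rw [hB, hRr]
    have h := hre.dotProduct_mulVec_nonneg x.ofLp
    have e : star x.ofLp ⬝ᵥ (-(matRe T)).mulVec x.ofLp =
        -∑ j, ∑ k, matRe T j k * x j * x k := by
      simp only [dotProduct, Matrix.mulVec, Pi.star_apply, star_trivial, Matrix.neg_apply,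
        Finset.mul_sum, ← Finset.sum_neg_distrib]
      refine Finset.sum_congr rfl fun j _ => Finset.sum_congr rfl fun k _ => by ring
    rw [e] at h
    linarith

/-- The substantive uniform statement: `δ` depends only on `d`, `s` and `μ` (not on `lam`, nor on
the family `T`). -/
theorem gaussian_family_uniform (d : ℕ) (hd : 1 ≤ d) (s : ℝ) (hs : 1 / 2 < s)
    (μ : ℝ) (hμ : 0 < μ) :
    ∃ δ : ℝ, 0 < δ ∧ ∀ (lam ε : ℝ), 0 < lam → lam ≤ δ → ∀ h : ℝ, 0 < h →
      ∃ C : ℝ, 0 < C ∧ ∀ (T : ℝ → Matrix (Fin (2 * d)) (Fin (2 * d)) ℂ),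
        (∀ t ∈ Set.Icc (0 : ℝ) ε, (T t).transpose = T t) →
        (∀ t ∈ Set.Icc (0 : ℝ) ε, (-(matRe (T t))).PosSemidef) →
        (∀ t ∈ Set.Icc (0 : ℝ) ε, spectrum ℝ (matRe (T t)) ⊆ Set.Icc (-lam) lam) →
        (∀ t ∈ Set.Icc (0 : ℝ) ε, spectrum ℝ (matIm (T t)) ⊆ Set.Icc (-lam) lam) →
        ∀ (z : EuclideanSpace ℝ (Fin (2 * d))) (α : Fin (2 * d) → ℕ),
          ∀ t ∈ Set.Icc (0 : ℝ) ε,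
            norm
                (pdMulti α
                  (fun w =>
                    Complex.exp ((1 / 2 : ℂ) * ∑ j, ∑ k, T t j k * (w j : ℂ) * (w k : ℂ))) z) ≤
              C * h ^ (∑ j, α j) * (∏ j, ((α j)! : ℝ)) ^ s *
                Real.exp (μ * h ^ (-(1 / s)) * ‖z‖ ^ (1 / s)) := by
  have hs0 : 0 < s := by linarith
  set N : ℝ := ((2 * d : ℕ) : ℝ) with hN
  have hN0 : 0 < N := by rw [hN]; exact_mod_cast (by omega : 0 < 2 * d)
  have hNs : 0 < N ^ s := by positivity
  refine ⟨(μ / s) ^ s / (8 * N ^ s), by positivity, ?_⟩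
  intro lam ε hlam hle h hh
  set g : ℝ := h / (4 * N ^ s) with hg
  have hg0 : 0 < g := by positivity
  set e : ℕ → ℝ := fun k => 2 * lam / g ^ 2 * (k / ((k : ℝ) ^ s * ((k : ℝ) + 1) ^ s)) with he
  obtain ⟨C, hC, hCb⟩ := prod_bound e (fun k => by simp only [he]; positivity) (e_tendsto s _ hs)
  refine ⟨C, hC, ?_⟩
  intro T hsym hre hR hI z α t ht
  obtain ⟨B, hB, hBn, hBs, hBr⟩ :=
    bilin_exists (T t) lam hlam (hsym t ht) (hre t ht) (hR t ht) (hI t ht)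
  simp only [← hB]
  obtain ⟨hsm, hfd⟩ := gauss_fderiv B hBs
  refine (pdMulti_bound α _ hsm z).trans ?_
  set f : EuclideanSpace ℝ (Fin (2 * d)) → ℂ :=
    fun w => Complex.exp ((1 / 2 : ℂ) * B w w) with hf
  obtain ⟨r1, r2⟩ := iter_rec B f hsm hfd (2 * lam) hBn z
  have r0 : ‖iteratedFDeriv ℝ 0 f z‖ ≤ 1 := by
    rw [norm_iteratedFDeriv_zero, hf, Complex.norm_exp, Real.exp_le_one_iff]
    have h1 : ((1 / 2 : ℂ) * B z z).re = 1 / 2 * (B z z).re := by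
      rw [show (1 / 2 : ℂ) = ((1 / 2 : ℝ) : ℂ) by push_cast; rfl, Complex.re_ofReal_mul]
    rw [h1]
    linarith [hBr z]
  set k := ∑ j, α j with hk
  have hA := num_rec s g (2 * lam) (2 * lam * ‖z‖) hg0 (by positivity) (by positivity) hs0
    (fun k => ‖iteratedFDeriv ℝ k f z‖) r0 r1 r2 e (fun k => rfl) k
  refine hA.trans ?_
  have hw := w_bound s (2 * lam * ‖z‖ / g) hs0 (by positivity) k
  have hfact : ((k ! : ℕ) : ℝ) ^ s ≤ (N ^ s) ^ k * (∏ j, ((α j)! : ℝ)) ^ s := by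
    refine (Real.rpow_le_rpow (by positivity) (fact_bound α) hs0.le).trans_eq ?_
    rw [Real.mul_rpow (by positivity) (by positivity), ← Real.rpow_natCast, ← Real.rpow_natCast,
      ← Real.rpow_mul hN0.le, ← Real.rpow_mul hN0.le, mul_comm s]
  have hexp : s * (2 * lam * ‖z‖ / g) ^ (1 / s) ≤ μ * h ^ (-(1 / s)) * ‖z‖ ^ (1 / s) := by
    have h1 : 2 * lam * ‖z‖ / g ≤ (μ / s) ^ s * (‖z‖ / h) := by
      have h2 : lam * (8 * N ^ s) ≤ (μ / s) ^ s := (le_div_iff₀ (by positivity)).1 hle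
      calc 2 * lam * ‖z‖ / g = lam * (8 * N ^ s) * (‖z‖ / h) := by
            rw [hg]; field_simp; ring
        _ ≤ _ := by gcongr
    calc s * (2 * lam * ‖z‖ / g) ^ (1 / s)
        ≤ s * ((μ / s) ^ s * (‖z‖ / h)) ^ (1 / s) := by gcongr
      _ = s * ((μ / s) * (‖z‖ ^ (1 / s) / h ^ (1 / s))) := by
        rw [Real.mul_rpow (by positivity) (by positivity), ← Real.rpow_mul (by positivity),
          mul_one_div_cancel hs0.ne', Real.rpow_one, Real.div_rpow (by positivity) hh.le]
      _ = _ := by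
        rw [Real.rpow_neg hh.le]
        field_simp
  have hexp' := Real.exp_le_exp.2 hexp
  calc (∏ i ∈ Finset.range k, (1 + e i)) * (g ^ k * ((k ! : ℝ)) ^ s *
        ∑ m ∈ Finset.range (k + 1), (2 * lam * ‖z‖ / g) ^ m / ((m ! : ℝ)) ^ s)
      ≤ (C * 2 ^ k) * (g ^ k * ((N ^ s) ^ k * (∏ j, ((α j)! : ℝ)) ^ s) *
        (2 ^ k * Real.exp (μ * h ^ (-(1 / s)) * ‖z‖ ^ (1 / s)))) := by
        refine mul_le_mul (hCb k) ?_ (by positivity) (by positivity)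
        refine mul_le_mul (by gcongr) (hw.trans (by gcongr)) (by positivity) (by positivity)
    _ = C * (2 * 2 * g * N ^ s) ^ k * (∏ j, ((α j)! : ℝ)) ^ s *
        Real.exp (μ * h ^ (-(1 / s)) * ‖z‖ ^ (1 / s)) := by
        rw [mul_pow, mul_pow, mul_pow]; ring
    _ = _ := by
        rw [show 2 * 2 * g * N ^ s = h by rw [hg]; field_simp; norm_num]

/-- Let `λ > 0`, `ε > 0`, `d ≥ 1`, `s > 1/2` and let `T_t ∈ ℂ^{2d×2d}`,
`0 ≤ t ≤ ε`, be symmetric matrices with `Re T_t ≤ 0` (negative semidefinite) and with all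
eigenvalues of `Re T_t` and `Im T_t` in `[−λ, λ]`.  Put `a_t(z) = exp(½⟨T_t z, z⟩)`.
For each `μ > 0` there is `δ > 0` such that, if `λ ≤ δ`, then for every `h > 0` there is
`C > 0` with `|∂^α a_t(z)| ≤ C h^{|α|} (α!)^s exp(μ h^{−1/s} |z|^{1/s})` for all `z`, `α`
and `t ∈ [0, ε]`. -/
theorem gaussian_family_estimate (d : ℕ) (hd : 1 ≤ d) (lam ε s : ℝ) (hlam : 0 < lam)
    (hε : 0 < ε) (hs : 1 / 2 < s)
    (T : ℝ → Matrix (Fin (2 * d)) (Fin (2 * d)) ℂ)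
    (hsym : ∀ t ∈ Set.Icc (0 : ℝ) ε, (T t).transpose = T t)
    (hre : ∀ t ∈ Set.Icc (0 : ℝ) ε, (-(matRe (T t))).PosSemidef)
    (hreEig : ∀ t ∈ Set.Icc (0 : ℝ) ε, spectrum ℝ (matRe (T t)) ⊆ Set.Icc (-lam) lam)
    (himEig : ∀ t ∈ Set.Icc (0 : ℝ) ε, spectrum ℝ (matIm (T t)) ⊆ Set.Icc (-lam) lam)
    (μ : ℝ) (hμ : 0 < μ) :
    ∃ δ : ℝ, 0 < δ ∧
      (lam ≤ δ → ∀ h : ℝ, 0 < h → ∃ C : ℝ, 0 < C ∧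
        ∀ (z : EuclideanSpace ℝ (Fin (2 * d))) (α : Fin (2 * d) → ℕ),
          ∀ t ∈ Set.Icc (0 : ℝ) ε,
            norm
                (pdMulti α
                  (fun w =>
                    Complex.exp ((1 / 2 : ℂ) * ∑ j, ∑ k, T t j k * (w j : ℂ) * (w k : ℂ))) z) ≤
              C * h ^ (∑ j, α j) * (∏ j, ((α j)! : ℝ)) ^ s *
                Real.exp (μ * h ^ (-(1 / s)) * ‖z‖ ^ (1 / s))) := by
  obtain ⟨δ, hδ, H⟩ := gaussian_family_uniform d hd s hs μ hμ
  refine ⟨δ, hδ, fun hle h hh => ?_⟩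
  obtain ⟨C, hC, HC⟩ := H lam ε hlam hle h hh
  exact ⟨C, hC, HC T hsym hre hreEig himEig⟩
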